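/- Let D_6 ⊂ ℝ⁴ be the convex hull of the 12 points (−1,−1,−1,−1), (−1,−1,−1,1), (−1,−1,0,−1), (−1,−1,2,1), (−1,1,−1,−1), (−1,1,0,−1), (−1,3,−1,1), (−1,3,2,1), (1,−1,−1,−1), (1,−1,0,−1), (3,−1,−1,1), (3,−1,2,1), and let θ be its extremal affine function. Then there exists δ > 0 (for instance δ = (155/1973)/vol(D_6)) such that I_θ(f) ≥ δ ∫_{D_6} f(x) dx for every normalized rational piecewise affine convex function f on D_6; i.e., the toric Fano fourfold X_{D_6} = ℙ_{ℙ¹×ℙ²}(𝒪 ⊕ 𝒪(1,1)) is uniformly relatively Ding polystable. -/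

import Mathlib

open MeasureTheory

/-- `P ⊆ ℝⁿ` is a (compact convex) polytope: the convex hull of finitely many points. -/
def IsPolytope {n : ℕ} (P : Set (Fin n → ℝ)) : Prop :=
  ∃ V : Finset (Fin n → ℝ), P = convexHull ℝ (V : Set (Fin n → ℝ))

/-- `θ : ℝⁿ → ℝ` is an affine function. -/
def IsAffineFn {n : ℕ} (θ : (Fin n → ℝ) → ℝ) : Prop :=
  ∃ (a : Fin n → ℝ) (c : ℝ), ∀ x, θ x = (∑ i, a i * x i) + c

/-- `θ` is the extremal affine function of `P`: it is affine, `∫_P θ = 0`, and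
`∫_P xᵢ θ = ∫_P xᵢ` for every `i`. -/
def IsExtremalAffine {n : ℕ} (P : Set (Fin n → ℝ)) (θ : (Fin n → ℝ) → ℝ) : Prop :=
  IsAffineFn θ ∧ (∫ x in P, θ x) = 0 ∧
    ∀ i : Fin n, (∫ x in P, x i * θ x) = ∫ x in P, x i

/-- The relative Ding invariant `I_θ(f) = -f(0) + (1/vol P) ∫_P f (1 - θ)`. -/
noncomputable def DingI {n : ℕ} (P : Set (Fin n → ℝ)) (θ f : (Fin n → ℝ) → ℝ) : ℝ :=
  -f 0 + (1 / (volume P).toReal) * ∫ x in P, f x * (1 - θ x)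

/-- `f` is a rational piecewise affine convex function: a finite maximum of affine functions
with rational coefficients. -/
def IsRatPLConvex {n : ℕ} (f : (Fin n → ℝ) → ℝ) : Prop :=
  ∃ (m : ℕ) (a : Fin (m + 1) → Fin n → ℚ) (c : Fin (m + 1) → ℚ),
    ∀ x, f x = Finset.univ.sup' Finset.univ_nonempty
      (fun k : Fin (m + 1) => (∑ i, (a k i : ℝ) * x i) + (c k : ℝ))

/-- `f` is normalized on `P`: `min_P f = f 0 = 0`. -/
def IsNormalized {n : ℕ} (P : Set (Fin n → ℝ)) (f : (Fin n → ℝ) → ℝ) : Prop :=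
  f 0 = 0 ∧ ∀ x ∈ P, 0 ≤ f x

/-- The Fano polytope `D₆ ⊆ ℝ⁴` of the toric Fano fourfold `ℙ_{ℙ¹×ℙ²}(𝒪 ⊕ 𝒪(1,1))`:
the convex hull of the 12 listed vertices. -/
noncomputable def D6 : Set (Fin 4 → ℝ) :=
  convexHull ℝ
    ({![-1, -1, -1, -1], ![-1, -1, -1, 1], ![-1, -1, 0, -1], ![-1, -1, 2, 1],
       ![-1, 1, -1, -1], ![-1, 1, 0, -1], ![-1, 3, -1, 1], ![-1, 3, 2, 1],
       ![1, -1, -1, -1], ![1, -1, 0, -1], ![3, -1, -1, 1], ![3, -1, 2, 1]} :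
      Set (Fin 4 → ℝ))

lemma D6_eq : D6 = {x : Fin 4 → ℝ | (-1 ≤ x 3 ∧ x 3 ≤ 1) ∧ (-1 ≤ x 2 ∧ x 2 ≤ 1 + x 3) ∧
    (-1 ≤ x 0 ∧ -1 ≤ x 1 ∧ x 0 + x 1 ≤ 1 + x 3)} := by
  apply Set.Subset.antisymm
  · apply convexHull_min
    · intro x hx
      simp only [Set.mem_insert_iff, Set.mem_singleton_iff] at hx
      rcases hx with h | h | h | h | h | h | h | h | h | h | h | h <;> subst h <;>
        simp <;> norm_num
    · intro x hx y hy a b ha hb hab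
      obtain ⟨⟨h1, h2⟩, ⟨h3, h4⟩, h5, h6, h7⟩ := hx
      obtain ⟨⟨k1, k2⟩, ⟨k3, k4⟩, k5, k6, k7⟩ := hy
      obtain rfl : b = 1 - a := by linarith
      simp only [Set.mem_ofPred_eq, Pi.add_apply, Pi.smul_apply, smul_eq_mul]
      refine ⟨⟨?_, ?_⟩, ⟨?_, ?_⟩, ?_, ?_, ?_⟩ <;> nlinarith
  · intro x hx
    obtain ⟨⟨h1, h2⟩, ⟨h3, h4⟩, h5, h6, h7⟩ := hx
    have hs : 0 < 3 + x 3 := by linarith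
    have hr : 0 < 2 + x 3 := by linarith
    obtain ⟨l, hl⟩ : ∃ l, l = (1 + x 3) / 2 := ⟨_, rfl⟩
    obtain ⟨a, ha⟩ : ∃ a, a = (x 0 + 1) / (3 + x 3) := ⟨_, rfl⟩
    obtain ⟨b, hb⟩ : ∃ b, b = (x 1 + 1) / (3 + x 3) := ⟨_, rfl⟩
    obtain ⟨m, hm⟩ : ∃ m, m = (x 2 + 1) / (2 + x 3) := ⟨_, rfl⟩
    have l0 : 0 ≤ l := by rw [hl]; linarith
    have l1 : 0 ≤ 1 - l := by rw [hl]; linarith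
    have a0 : 0 ≤ a := by rw [ha]; apply div_nonneg <;> linarith
    have b0 : 0 ≤ b := by rw [hb]; apply div_nonneg <;> linarith
    have m0 : 0 ≤ m := by rw [hm]; apply div_nonneg <;> linarith
    have m1 : 0 ≤ 1 - m := by
      rw [hm, sub_nonneg, div_le_one hr]; linarith
    have c0 : 0 ≤ 1 - a - b := by
      have : a + b ≤ 1 := by rw [ha, hb, ← add_div, div_le_one hs]; linarith
      linarith
    have e3 : x 3 = 2 * l - 1 := by rw [hl]; ring
    have e0 : x 0 = a * (2 + 2 * l) - 1 := by
      have : a * (3 + x 3) = x 0 + 1 := by rw [ha]; field_simp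
      rw [e3] at this; linarith
    have e1 : x 1 = b * (2 + 2 * l) - 1 := by
      have : b * (3 + x 3) = x 1 + 1 := by rw [hb]; field_simp
      rw [e3] at this; linarith
    have e2 : x 2 = m * (1 + 2 * l) - 1 := by
      have : m * (2 + x 3) = x 2 + 1 := by rw [hm]; field_simp
      rw [e3] at this; linarith
    clear hl ha hb hm
    let w : Fin 12 → ℝ := ![(1-l)*(1-a-b)*(1-m), l*(1-a-b)*(1-m), (1-l)*(1-a-b)*m, l*(1-a-b)*m,
      (1-l)*b*(1-m), (1-l)*b*m, l*b*(1-m), l*b*m,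
      (1-l)*a*(1-m), (1-l)*a*m, l*a*(1-m), l*a*m]
    let z : Fin 12 → (Fin 4 → ℝ) :=
      ![![-1, -1, -1, -1], ![-1, -1, -1, 1], ![-1, -1, 0, -1], ![-1, -1, 2, 1],
       ![-1, 1, -1, -1], ![-1, 1, 0, -1], ![-1, 3, -1, 1], ![-1, 3, 2, 1],
       ![1, -1, -1, -1], ![1, -1, 0, -1], ![3, -1, -1, 1], ![3, -1, 2, 1]]
    have key : ∑ i, w i • z i ∈ D6 := by
      apply (convex_convexHull ℝ _).sum_mem
      · intro i _
        fin_cases i <;> simp only [w] <;> simp <;> positivity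
      · simp [Fin.sum_univ_succ, w]; ring
      · intro i _
        apply subset_convexHull
        fin_cases i <;> simp [z]
    convert key using 1
    ext i
    fin_cases i <;> simp [Fin.sum_univ_succ, w, z]
    · rw [e0]; ring
    · rw [e1]; ring
    · rw [e2]; ring
    · rw [e3]; ring

lemma D6_compact : IsCompact D6 := by
  apply Set.Finite.isCompact_convexHull
  exact Set.toFinite _

def E4 (p : ℝ × ℝ × ℝ × ℝ) : Fin 4 → ℝ := ![p.2.2.1, p.2.2.2, p.2.1, p.1]

lemma E4_mp : MeasurePreserving E4 volume volume ∧ MeasurableEmbedding E4 := by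
  let e1 := (MeasurableEquiv.piFinSuccAbove (fun _ : Fin 4 => ℝ) 3).symm
  let e2 := (MeasurableEquiv.piFinSuccAbove (fun _ : Fin 3 => ℝ) 2).symm
  let e3 := (MeasurableEquiv.finTwoArrow (α := ℝ)).symm
  have h1 : MeasurePreserving e1 volume volume :=
    (volume_preserving_piFinSuccAbove (fun _ : Fin 4 => ℝ) 3).symm _
  have h2 : MeasurePreserving e2 volume volume :=
    (volume_preserving_piFinSuccAbove (fun _ : Fin 3 => ℝ) 2).symm _
  have h3 : MeasurePreserving e3 volume volume :=
    (volume_preserving_finTwoArrow ℝ).symm _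
  let r := (MeasurableEquiv.refl ℝ)
  have hr : MeasurePreserving r volume volume := MeasurePreserving.id _
  let e23 := (r.prodCongr e3).trans e2
  have h23 : MeasurePreserving e23 volume volume := h2.comp (hr.prod h3)
  let e := (r.prodCongr e23).trans e1
  have h : MeasurePreserving e volume volume := h1.comp (hr.prod h23)
  have he : (e : _ → _) = E4 := by
    funext p
    obtain ⟨t, z, x, y⟩ := p
    funext i
    fin_cases i <;> rfl
  rw [← he]
  exact ⟨h, e.measurableEmbedding⟩

/-- The triangle slice. -/
def Tri (t : ℝ) : Set (ℝ × ℝ) := {q | -1 ≤ q.1 ∧ -1 ≤ q.2 ∧ q.1 + q.2 ≤ 1 + t}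

lemma Tri_compact (t : ℝ) : IsCompact (Tri t) := by
  apply (isCompact_Icc (a := ((-1 : ℝ), (-1 : ℝ))) (b := (2 + t, 2 + t))).of_isClosed_subset
  · have h : Tri t = {q : ℝ × ℝ | -1 ≤ q.1} ∩ ({q | -1 ≤ q.2} ∩ {q | q.1 + q.2 ≤ 1 + t}) := rfl
    rw [h]
    refine (isClosed_le (by fun_prop) (by fun_prop)).inter
      ((isClosed_le (by fun_prop) (by fun_prop)).inter (isClosed_le (by fun_prop) (by fun_prop)))
  · rintro ⟨x, y⟩ ⟨h1, h2, h3⟩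
    simp only at h1 h2 h3
    simp only [Set.mem_Icc, Prod.mk_le_mk]
    refine ⟨⟨?_, ?_⟩, ?_, ?_⟩ <;> linarith

lemma int_D6 (φ c : ℝ → ℝ) (d : ℝ × ℝ → ℝ) (hφ : Continuous φ) (hc : Continuous c)
    (hd : Continuous d) :
    ∫ x in D6, φ (x 3) * (c (x 2) * d (x 0, x 1)) =
      ∫ t in Set.Icc (-1 : ℝ) 1, φ t * ((∫ z in Set.Icc (-1 : ℝ) (1 + t), c z) *
        ∫ q in Tri t, d q) := by
  have hint : IntegrableOn (fun x : Fin 4 → ℝ => φ (x 3) * (c (x 2) * d (x 0, x 1))) D6 :=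
    (Continuous.continuousOn (by fun_prop)).integrableOn_compact D6_compact
  obtain ⟨hE, hEe⟩ := E4_mp
  rw [← hE.setIntegral_preimage_emb hEe]
  rw [← hE.integrableOn_comp_preimage hEe] at hint
  have hmeas : MeasurableSet (E4 ⁻¹' D6) := hEe.measurable D6_compact.measurableSet
  rw [← integral_indicator hmeas, ← integral_indicator measurableSet_Icc]
  rw [← integrable_indicator_iff hmeas] at hint
  rw [show (volume : Measure (ℝ × ℝ × ℝ × ℝ)) = (volume : Measure ℝ).prod volume from rfl] at hint ⊢
  rw [integral_prod]
  swap
  · exact hint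
  congr 1
  funext t
  by_cases ht : t ∈ Set.Icc (-1 : ℝ) 1
  · rw [Set.indicator_of_mem ht, ← integral_indicator measurableSet_Icc,
      ← integral_indicator (Tri_compact t).measurableSet, ← integral_prod_mul, ← integral_const_mul]
    congr 1
    funext ⟨z, x, y⟩
    by_cases h1 : z ∈ Set.Icc (-1 : ℝ) (1 + t)
    · by_cases h2 : (x, y) ∈ Tri t
      · rw [Set.indicator_of_mem, Set.indicator_of_mem h1, Set.indicator_of_mem h2]
        · rfl
        · rw [Set.mem_preimage, D6_eq]
          exact ⟨ht, h1, h2⟩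
      · rw [Set.indicator_of_notMem, Set.indicator_of_notMem h2]
        · simp
        · rw [Set.mem_preimage, D6_eq]
          exact fun h => h2 h.2.2
    · rw [Set.indicator_of_notMem, Set.indicator_of_notMem h1]
      · simp
      · rw [Set.mem_preimage, D6_eq]
        exact fun h => h1 h.2.1
  · rw [Set.indicator_of_notMem ht]
    refine integral_eq_zero_of_ae (Filter.Eventually.of_forall fun y => ?_)
    apply Set.indicator_of_notMem
    rw [Set.mem_preimage, D6_eq]
    exact fun h => ht h.1

lemma int_Tri (t : ℝ) (ht : -1 ≤ t) (d : ℝ × ℝ → ℝ) (hd : Continuous d) :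
    ∫ q in Tri t, d q = ∫ x in (-1 : ℝ)..(2 + t), ∫ y in (-1 : ℝ)..(1 + t - x), d (x, y) := by
  have hint : IntegrableOn d (Tri t) := hd.continuousOn.integrableOn_compact (Tri_compact t)
  have hm := (Tri_compact t).measurableSet
  rw [← integral_indicator hm]
  rw [← integrable_indicator_iff hm] at hint
  rw [show (volume : Measure (ℝ × ℝ)) = (volume : Measure ℝ).prod volume from rfl] at hint ⊢
  rw [integral_prod _ hint, intervalIntegral.integral_of_le (by linarith),
    ← integral_Icc_eq_integral_Ioc, ← integral_indicator measurableSet_Icc]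
  congr 1
  funext x
  by_cases hx : x ∈ Set.Icc (-1 : ℝ) (2 + t)
  · rw [Set.indicator_of_mem hx, intervalIntegral.integral_of_le (by linarith [hx.2]),
      ← integral_Icc_eq_integral_Ioc, ← integral_indicator measurableSet_Icc]
    congr 1
    funext y
    by_cases hy : y ∈ Set.Icc (-1 : ℝ) (1 + t - x)
    · rw [Set.indicator_of_mem hy, Set.indicator_of_mem]
      exact ⟨hx.1, hy.1, by simp only; linarith [hy.2]⟩
    · rw [Set.indicator_of_notMem hy, Set.indicator_of_notMem]
      rintro ⟨h1, h2, h3⟩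
      simp only at h1 h2 h3
      exact hy ⟨h2, by linarith⟩
  · rw [Set.indicator_of_notMem hx]
    refine integral_eq_zero_of_ae (Filter.Eventually.of_forall fun y => ?_)
    apply Set.indicator_of_notMem
    rintro ⟨h1, h2, h3⟩
    simp only at h1 h2 h3
    exact hx ⟨h1, by linarith⟩

lemma int_lin (u v q : ℝ) : ∫ x in u..v, q * x = q * ((v ^ 2 - u ^ 2) / 2) := by
  rw [intervalIntegral.integral_const_mul, integral_id]

lemma int_quad (u v p q r : ℝ) : ∫ x in u..v, (p + q * x + r * x ^ 2) =
    p * (v - u) + q * (v ^ 2 - u ^ 2) / 2 + r * (v ^ 3 - u ^ 3) / 3 := by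
  rw [intervalIntegral.integral_add, intervalIntegral.integral_add]
  · rw [int_lin]
    simp only [intervalIntegral.integral_const_mul, intervalIntegral.integral_const, integral_pow,
      smul_eq_mul]
    norm_num
    ring
  all_goals exact (Continuous.intervalIntegrable (by fun_prop) _ _)

lemma tri_one (t : ℝ) (ht : -1 ≤ t) : ∫ _q in Tri t, (1 : ℝ) = (3 + t) ^ 2 / 2 := by
  rw [int_Tri t ht _ (by fun_prop)]
  have : ∀ x : ℝ, ∫ y in (-1 : ℝ)..(1 + t - x), (1 : ℝ) = (2 + t) + (-1) * x + 0 * x ^ 2 := by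
    intro x; simp; ring
  simp only [this]
  rw [int_quad]; ring

lemma tri_x (t : ℝ) (ht : -1 ≤ t) : ∫ q in Tri t, q.1 = (t / 3) * ((3 + t) ^ 2 / 2) := by
  rw [int_Tri t ht _ (by fun_prop)]
  have : ∀ x : ℝ, ∫ y in (-1 : ℝ)..(1 + t - x), x = 0 + (2 + t) * x + (-1) * x ^ 2 := by
    intro x; simp; ring
  simp only [this]
  rw [int_quad]; ring

lemma tri_y (t : ℝ) (ht : -1 ≤ t) : ∫ q in Tri t, q.2 = (t / 3) * ((3 + t) ^ 2 / 2) := by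
  rw [int_Tri t ht _ (by fun_prop)]
  have : ∀ x : ℝ, ∫ y in (-1 : ℝ)..(1 + t - x), y =
      ((1 + t) ^ 2 - 1) / 2 + (-(1 + t)) * x + (1 / 2) * x ^ 2 := by
    intro x; rw [integral_id]; ring
  simp only [this]
  rw [int_quad]; ring

lemma z_one (t : ℝ) (ht : -1 ≤ t) : ∫ _z in Set.Icc (-1 : ℝ) (1 + t), (1 : ℝ) = 2 + t := by
  rw [integral_Icc_eq_integral_Ioc, ← intervalIntegral.integral_of_le (by linarith)]
  simp; ring

lemma z_z (t : ℝ) (ht : -1 ≤ t) : ∫ z in Set.Icc (-1 : ℝ) (1 + t), z = (t / 2) * (2 + t) := by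
  rw [integral_Icc_eq_integral_Ioc, ← intervalIntegral.integral_of_le (by linarith), integral_id]
  ring

/-- The pushforward integral to the last coordinate. -/
noncomputable def J (φ : ℝ → ℝ) : ℝ := ∫ t in (-1 : ℝ)..1, φ t * ((2 + t) * ((3 + t) ^ 2 / 2))

lemma J_of (φ ψ : ℝ → ℝ) (h : ∀ t, -1 ≤ t → ψ t = φ t * ((2 + t) * ((3 + t) ^ 2 / 2))) :
    ∫ t in Set.Icc (-1 : ℝ) 1, ψ t = J φ := by
  rw [J, intervalIntegral.integral_of_le (by norm_num), ← integral_Icc_eq_integral_Ioc]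
  exact setIntegral_congr_fun measurableSet_Icc (fun t ht => h t ht.1)

lemma D6_t (φ : ℝ → ℝ) (hφ : Continuous φ) : ∫ x in D6, φ (x 3) = J φ := by
  have := int_D6 φ (fun _ => 1) (fun _ => 1) hφ (by fun_prop) (by fun_prop)
  simp only [mul_one] at this
  rw [this]
  apply J_of
  intro t ht
  rw [tri_one t ht, z_one t ht]

lemma D6_x0 (φ : ℝ → ℝ) (hφ : Continuous φ) :
    ∫ x in D6, φ (x 3) * x 0 = J (fun t => φ t * (t / 3)) := by
  have := int_D6 φ (fun _ => 1) (fun q => q.1) hφ (by fun_prop) (by fun_prop)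
  simp only [one_mul] at this
  rw [this]
  apply J_of
  intro t ht
  rw [tri_x t ht, z_one t ht]; ring

lemma D6_x1 (φ : ℝ → ℝ) (hφ : Continuous φ) :
    ∫ x in D6, φ (x 3) * x 1 = J (fun t => φ t * (t / 3)) := by
  have := int_D6 φ (fun _ => 1) (fun q => q.2) hφ (by fun_prop) (by fun_prop)
  simp only [one_mul] at this
  rw [this]
  apply J_of
  intro t ht
  rw [tri_y t ht, z_one t ht]; ring

lemma D6_x2 (φ : ℝ → ℝ) (hφ : Continuous φ) :
    ∫ x in D6, φ (x 3) * x 2 = J (fun t => φ t * (t / 2)) := by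
  have := int_D6 φ (fun z => z) (fun _ => 1) hφ (by fun_prop) (by fun_prop)
  simp only [mul_one] at this
  rw [this]
  apply J_of
  intro t ht
  rw [tri_one t ht, z_z t ht]; ring

lemma J_quad (p q r : ℝ) : J (fun t => p + q * t + r * t ^ 2) =
    (p * (124 / 3) + q * (72 / 5) + r * (76 / 5)) / 2 := by
  have h : ∀ t : ℝ, (p + q * t + r * t ^ 2) * ((2 + t) * ((3 + t) ^ 2 / 2)) =
      9 * p + (21 / 2 * p + 9 * q) * t + (4 * p + 21 / 2 * q + 9 * r) * t ^ 2 +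
      (p / 2 + 4 * q + 21 / 2 * r) * t ^ 3 + (q / 2 + 4 * r) * t ^ 4 + (r / 2) * t ^ 5 := by
    intro t; ring
  simp only [J, h]
  repeat rw [intervalIntegral.integral_add]
  · rw [int_lin]
    simp only [intervalIntegral.integral_const_mul, intervalIntegral.integral_const, integral_pow,
      smul_eq_mul]
    norm_num
    ring
  all_goals exact (Continuous.intervalIntegrable (by fun_prop) _ _)

/-- The explicit extremal affine function. -/
noncomputable def th (x : Fin 4 → ℝ) : ℝ := (2790 * x 3 - 972) / 1973

lemma th_cont : Continuous th := by unfold th; fun_prop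

lemma th_zero : ∫ x in D6, th x = 0 := by
  have := D6_t (fun t => (2790 * t - 972) / 1973) (by fun_prop)
  refine this.trans ?_
  rw [show (fun t : ℝ => (2790 * t - 972) / 1973) =
    fun t => (-972 / 1973) + (2790 / 1973) * t + 0 * t ^ 2 by funext t; ring, J_quad]
  norm_num

lemma th_mom (i : Fin 4) : ∫ x in D6, x i * th x = ∫ x in D6, x i := by
  have key : ∀ k : ℝ, J (fun t => (2790 * t - 972) / 1973 * (t / k)) = J (fun t => t / k) := by
    intro k
    rw [show (fun t : ℝ => (2790 * t - 972) / 1973 * (t / k)) =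
      fun t => 0 + (-972 / 1973 / k) * t + (2790 / 1973 / k) * t ^ 2 by funext t; ring,
      show (fun t : ℝ => t / k) = fun t => 0 + (1 / k) * t + 0 * t ^ 2 by funext t; ring,
      J_quad, J_quad]
    ring
  simp only [mul_comm _ (th _)]
  fin_cases i
  · have h1 := D6_x0 (fun t => (2790 * t - 972) / 1973) (by fun_prop)
    have h2 := D6_x0 (fun t => 1) (by fun_prop)
    simp only [one_mul] at h1 h2
    exact h1.trans ((key _).trans h2.symm)
  · have h1 := D6_x1 (fun t => (2790 * t - 972) / 1973) (by fun_prop)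
    have h2 := D6_x1 (fun t => 1) (by fun_prop)
    simp only [one_mul] at h1 h2
    exact h1.trans ((key _).trans h2.symm)
  · have h1 := D6_x2 (fun t => (2790 * t - 972) / 1973) (by fun_prop)
    have h2 := D6_x2 (fun t => 1) (by fun_prop)
    simp only [one_mul] at h1 h2
    exact h1.trans ((key _).trans h2.symm)
  · have h1 := D6_t (fun t => (2790 * t - 972) / 1973 * (t / 1)) (by fun_prop)
    have h2 := D6_t (fun t => t / 1) (by fun_prop)
    have h3 := key 1
    simp only [div_one] at h1 h2 h3
    exact h1.trans (h3.trans h2.symm)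

lemma D6_vol : (volume D6).toReal = 62 / 3 := by
  have h := D6_t (fun _ => 1) (by fun_prop)
  have h' := J_quad 1 0 0
  simp only [zero_mul, add_zero] at h'
  rw [h'] at h
  simp [Measure.real] at h
  rw [h]; norm_num

lemma ci {g : (Fin 4 → ℝ) → ℝ} (hg : Continuous g) : IntegrableOn g D6 :=
  hg.continuousOn.integrableOn_compact D6_compact

lemma theta_ae (θ : (Fin 4 → ℝ) → ℝ) (hθ : IsExtremalAffine D6 θ) :
    ∀ᵐ x ∂(volume.restrict D6), θ x = th x := by
  obtain ⟨⟨a, c, hac⟩, h0, hi⟩ := hθ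
  have hc : Continuous θ := by
    rw [show θ = fun x => (∑ i, a i * x i) + c from funext hac]; fun_prop
  have tc := th_cont
  let b : Fin 4 → ℝ := ![a 0, a 1, a 2, a 3 - 2790 / 1973]
  have hg : ∀ x, θ x - th x = (∑ i, b i * x i) + (c + 972 / 1973) := by
    intro x; rw [hac]; simp [Fin.sum_univ_four, b, th]; ring
  have g0 : ∫ x in D6, (θ x - th x) = 0 := by
    rw [integral_sub (ci hc) (ci tc), h0, th_zero, sub_zero]
  have gi : ∀ i, ∫ x in D6, x i * (θ x - th x) = 0 := by
    intro i
    simp only [mul_sub]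
    rw [integral_sub (ci (by fun_prop)) (ci (by fun_prop)), hi, th_mom, sub_self]
  have gsq : ∫ x in D6, (θ x - th x) ^ 2 = 0 := by
    have : ∀ x, (θ x - th x) ^ 2 =
        (∑ i, b i * (x i * (θ x - th x))) + (c + 972 / 1973) * (θ x - th x) := by
      intro x
      rw [sq]
      nth_rewrite 1 [hg x]
      rw [add_mul, Finset.sum_mul]
      simp only [mul_assoc]
    simp only [this]
    rw [integral_add (ci (by fun_prop)) (ci (by fun_prop)),
      integral_finsetSum _ (fun i _ => ci (by fun_prop))]
    simp only [integral_const_mul, g0, gi]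
    simp
  have hint : IntegrableOn (fun x => (θ x - th x) ^ 2) D6 := ci ((hc.sub tc).pow 2)
  rw [integral_eq_zero_iff_of_nonneg (fun x => sq_nonneg _) hint] at gsq
  filter_upwards [gsq] with x hx
  have : (θ x - th x) ^ 2 = 0 := hx
  have := pow_eq_zero_iff (two_ne_zero) |>.1 this
  linarith

theorem D6_uniformly_relatively_Ding_polystable
    (θ : (Fin 4 → ℝ) → ℝ) (hθ : IsExtremalAffine D6 θ) :
    ∃ δ > (0 : ℝ), ∀ f : (Fin 4 → ℝ) → ℝ, IsRatPLConvex f → IsNormalized D6 f →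
      δ * (∫ x in D6, f x) ≤ DingI D6 θ f := by
  have hae := theta_ae θ hθ
  have hc : Continuous θ := by
    obtain ⟨⟨a, c, hac⟩, -⟩ := hθ
    rw [show θ = fun x => (∑ i, a i * x i) + c from funext hac]; fun_prop
  refine ⟨(1 / (62 / 3)) * (155 / 1973), by norm_num, ?_⟩
  rintro f ⟨m, a, c, hf⟩ ⟨f0, hpos⟩
  have hfc : Continuous f := by
    rw [show f = _ from funext hf]
    apply Continuous.finset_sup'_apply
    intro i _
    fun_prop
  rw [DingI, f0, D6_vol, neg_zero, zero_add, mul_assoc, ← integral_const_mul]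
  apply mul_le_mul_of_nonneg_left _ (by norm_num)
  apply integral_mono_ae (ci (by fun_prop)) (ci (by fun_prop))
  filter_upwards [hae, ae_restrict_mem D6_compact.measurableSet] with x hx hxD
  have h1 := hpos x hxD
  rw [D6_eq] at hxD
  have h2 := hxD.1.2
  simp only [hx, th]
  rw [mul_comm]
  apply mul_le_mul_of_nonneg_left _ h1
  linarith
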